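/- (Peak error bounds for non-intrusive shadowing.) In the hyperbolic linear cocycle setting with C₁ = 1 and bounded inhomogeneity, fix an integer K ≥ 1, and define for 0 ≤ k ≤ K−1: the shadowing direction v_k := Σ_{n≥0} Φ_{k−n}^{(n)} P⁻_{k−n} X_{k−n} − Σ_{n≥1} Φ_{k+n}^{(−n)} P⁺_{k+n} X_{k+n}; the pivot solution v^P_k := Σ_{n=0}^{k−1} Φ_{k−n}^{(n)} P⁻_{k−n} X_{k−n} − Σ_{n≥1} Φ_{k+n}^{(−n)} P⁺_{k+n} X_{k+n}; the scalar bound v^A_k := Σ_{n≥0} ‖Φ_{k−n}^{(n)} P⁻_{k−n} X_{k−n}‖ + Σ_{n≥1} ‖Φ_{k+n}^{(−n)} P⁺_{k+n} X_{k+n}‖; and let v^N be a minimizer of Σ_{k=0}^{K−1} ‖v_k‖² over all finite sequences (v_k)_{0≤k≤K−1} satisfying v_{k+1} = A_k v_k + X_{k+1} for 0 ≤ k ≤ K−2 and P⁻_0 v_0 = 0. Then: (i) e^{PN}_k := v^P_k − v^N_k lies in range(P⁺_k) for every 0 ≤ k ≤ K−1; (ii) ‖e^{PN}_{K−1}‖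 ≤ Σ_{k=0}^{K−1} λ^{K−1−k} v^A_k; and (iii) e^P := v^P − v satisfies ‖e^P_0‖ ≤ v^A_0. -/

import Mathlib

/-- The cocycle `Φ_k^{(n)} := A_{k+n−1} ∘ ⋯ ∘ A_k`, with `Φ_k^{(0)} = id`;
`Φ_k^{(−n)}` is realized as `(Phi A (k−n) n).symm`. -/
noncomputable def Phi {M : ℕ}
    (A : ℤ → EuclideanSpace ℝ (Fin M) ≃L[ℝ] EuclideanSpace ℝ (Fin M)) :
    ℤ → ℕ → (EuclideanSpace ℝ (Fin M) ≃L[ℝ] EuclideanSpace ℝ (Fin M))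
  | _, 0 => ContinuousLinearEquiv.refl ℝ _
  | k, (n + 1) => (Phi A k n).trans (A (k + n))

/-- The shadowing direction
`v_k := Σ_{n≥0} Φ_{k−n}^{(n)} P⁻_{k−n} X_{k−n} − Σ_{n≥1} Φ_{k+n}^{(−n)} P⁺_{k+n} X_{k+n}`. -/
noncomputable def sdir {M : ℕ}
    (A : ℤ → EuclideanSpace ℝ (Fin M) ≃L[ℝ] EuclideanSpace ℝ (Fin M))
    (Pp Pm : ℤ → EuclideanSpace ℝ (Fin M) →L[ℝ] EuclideanSpace ℝ (Fin M))
    (X : ℤ → EuclideanSpace ℝ (Fin M)) (k : ℤ) : EuclideanSpace ℝ (Fin M) :=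
  (∑' n : ℕ, Phi A (k - n) n (Pm (k - n) (X (k - n))))
    - ∑' n : ℕ, (Phi A k (n + 1)).symm (Pp (k + n + 1) (X (k + n + 1)))

/-- The pivot solution
`v^P_k := Σ_{n=0}^{k−1} Φ_{k−n}^{(n)} P⁻_{k−n} X_{k−n} − Σ_{n≥1} Φ_{k+n}^{(−n)} P⁺_{k+n} X_{k+n}`. -/
noncomputable def vpivot {M : ℕ}
    (A : ℤ → EuclideanSpace ℝ (Fin M) ≃L[ℝ] EuclideanSpace ℝ (Fin M))
    (Pp Pm : ℤ → EuclideanSpace ℝ (Fin M) →L[ℝ] EuclideanSpace ℝ (Fin M))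
    (X : ℤ → EuclideanSpace ℝ (Fin M)) (k : ℕ) : EuclideanSpace ℝ (Fin M) :=
  (∑ n ∈ Finset.range k, Phi A ((k : ℤ) - n) n (Pm ((k : ℤ) - n) (X ((k : ℤ) - n))))
    - ∑' n : ℕ, (Phi A (k : ℤ) (n + 1)).symm (Pp ((k : ℤ) + n + 1) (X ((k : ℤ) + n + 1)))

/-- The scalar bound
`v^A_k := Σ_{n≥0} ‖Φ_{k−n}^{(n)} P⁻_{k−n} X_{k−n}‖ + Σ_{n≥1} ‖Φ_{k+n}^{(−n)} P⁺_{k+n} X_{k+n}‖`. -/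
noncomputable def vabs {M : ℕ}
    (A : ℤ → EuclideanSpace ℝ (Fin M) ≃L[ℝ] EuclideanSpace ℝ (Fin M))
    (Pp Pm : ℤ → EuclideanSpace ℝ (Fin M) →L[ℝ] EuclideanSpace ℝ (Fin M))
    (X : ℤ → EuclideanSpace ℝ (Fin M)) (k : ℤ) : ℝ :=
  (∑' n : ℕ, ‖Phi A (k - n) n (Pm (k - n) (X (k - n)))‖)
    + ∑' n : ℕ, ‖(Phi A k (n + 1)).symm (Pp (k + n + 1) (X (k + n + 1)))‖

section Cocycle

variable {M : ℕ} {A : ℤ → EuclideanSpace ℝ (Fin M) ≃L[ℝ] EuclideanSpace ℝ (Fin M)}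
  {Pp Pm : ℤ → EuclideanSpace ℝ (Fin M) →L[ℝ] EuclideanSpace ℝ (Fin M)}
  {X : ℤ → EuclideanSpace ℝ (Fin M)} {lam χ : ℝ}

theorem Phi_succ_apply (k : ℤ) (n : ℕ) (x : EuclideanSpace ℝ (Fin M)) :
    Phi A k (n + 1) x = A (k + n) (Phi A k n x) := rfl

theorem Phi_succ_apply' (k : ℤ) (n : ℕ) (x : EuclideanSpace ℝ (Fin M)) :
    Phi A k (n + 1) x = Phi A (k + 1) n (A k x) := by
  induction n with
  | zero => simp [Phi]
  | succ n ih =>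
    rw [Phi_succ_apply, ih, Phi_succ_apply]
    congr 2
    push_cast
    ring

theorem map_Phi_succ_symm (k : ℤ) (n : ℕ) (y : EuclideanSpace ℝ (Fin M)) :
    A k ((Phi A k (n + 1)).symm y) = (Phi A (k + 1) n).symm y := by
  apply (Phi A (k + 1) n).injective
  rw [← Phi_succ_apply', ContinuousLinearEquiv.apply_symm_apply,
    ContinuousLinearEquiv.apply_symm_apply]

theorem Phi_comm_proj (hequiv : ∀ k x, A k (Pp k x) = Pp (k + 1) (A k x)) (k : ℤ) (n : ℕ)
    (x : EuclideanSpace ℝ (Fin M)) : Phi A k n (Pp k x) = Pp (k + n) (Phi A k n x) := by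
  induction n with
  | zero => simp [Phi]
  | succ n ih =>
    rw [Phi_succ_apply, ih, hequiv, Phi_succ_apply]
    congr 2
    push_cast
    ring

theorem Phi_symm_proj (hequiv : ∀ k x, A k (Pp k x) = Pp (k + 1) (A k x)) (k : ℤ) (n : ℕ)
    (y : EuclideanSpace ℝ (Fin M)) :
    (Phi A k n).symm (Pp (k + n) y) = Pp k ((Phi A k n).symm y) := by
  apply (Phi A k n).injective
  rw [Phi_comm_proj hequiv, ContinuousLinearEquiv.apply_symm_apply,
    ContinuousLinearEquiv.apply_symm_apply]

theorem norm_Phi_symm_le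
    (hunstab : ∀ (k : ℤ) (n : ℕ) (x), ‖(Phi A (k - n) n).symm (Pp k x)‖ ≤ lam ^ n * ‖x‖)
    (k : ℤ) (n : ℕ) (x : EuclideanSpace ℝ (Fin M)) :
    ‖(Phi A k n).symm (Pp (k + n) x)‖ ≤ lam ^ n * ‖x‖ := by
  simpa using hunstab (k + n) n x

theorem summable_norm_stable (hlam0 : 0 < lam) (hlam1 : lam < 1)
    (hstab : ∀ (k : ℤ) (n : ℕ) (x), ‖Phi A k n (Pm k x)‖ ≤ lam ^ n * ‖x‖)
    (hχ : ∀ k, ‖X k‖ ≤ χ) (k : ℤ) :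
    Summable fun n : ℕ => ‖Phi A (k - n) n (Pm (k - n) (X (k - n)))‖ := by
  refine Summable.of_nonneg_of_le (fun _ => norm_nonneg _) (fun n => (hstab _ n _).trans ?_)
    ((summable_geometric_of_lt_one hlam0.le hlam1).mul_right χ)
  gcongr
  exact hχ _

theorem summable_norm_unstable (hlam0 : 0 < lam) (hlam1 : lam < 1)
    (hunstab : ∀ (k : ℤ) (n : ℕ) (x), ‖(Phi A (k - n) n).symm (Pp k x)‖ ≤ lam ^ n * ‖x‖)
    (hχ : ∀ k, ‖X k‖ ≤ χ) (k : ℤ) :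
    Summable fun n : ℕ => ‖(Phi A k (n + 1)).symm (Pp (k + n + 1) (X (k + n + 1)))‖ := by
  refine Summable.of_nonneg_of_le (fun _ => norm_nonneg _) (fun n => ?_)
    (((summable_nat_add_iff 1).2 (summable_geometric_of_lt_one hlam0.le hlam1)).mul_right χ)
  have h := norm_Phi_symm_le hunstab k (n + 1) (X (k + n + 1))
  rw [Nat.cast_succ, ← add_assoc] at h
  refine h.trans ?_
  gcongr
  exact hχ _

theorem vpivot_succ (hsum : ∀ k x, Pp k x + Pm k x = x)
    (k : ℕ)
    (hs : Summable fun n : ℕ =>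
      (Phi A (k : ℤ) (n + 1)).symm (Pp ((k : ℤ) + n + 1) (X ((k : ℤ) + n + 1)))) :
    vpivot A Pp Pm X (k + 1) = A (k : ℤ) (vpivot A Pp Pm X k) + X ((k : ℤ) + 1) := by
  have hmap := (A (k : ℤ)).map_tsum (L := .unconditional ℕ)
    (f := fun n : ℕ => (Phi A (k : ℤ) (n + 1)).symm (Pp ((k : ℤ) + n + 1) (X ((k : ℤ) + n + 1))))
  have hs' := (A (k : ℤ)).summable.2 hs
  simp only [map_Phi_succ_symm] at hmap hs'
  rw [hs'.tsum_eq_zero_add] at hmap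
  unfold vpivot
  rw [map_sub, hmap, map_sum, Finset.sum_range_succ']
  have hfin : ∀ n : ℕ, Phi A (((k + 1 : ℕ) : ℤ) - ((n + 1 : ℕ) : ℤ)) (n + 1)
        (Pm (((k + 1 : ℕ) : ℤ) - ((n + 1 : ℕ) : ℤ)) (X (((k + 1 : ℕ) : ℤ) - ((n + 1 : ℕ) : ℤ))))
      = A (k : ℤ) (Phi A ((k : ℤ) - n) n (Pm ((k : ℤ) - n) (X ((k : ℤ) - n)))) := by
    intro n
    have : ((k + 1 : ℕ) : ℤ) - ((n + 1 : ℕ) : ℤ) = (k : ℤ) - n := by push_cast; ring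
    rw [this, Phi_succ_apply, sub_add_cancel]
  have htail : ∀ n : ℕ, (k : ℤ) + ((n + 1 : ℕ) : ℤ) + 1 = ((k + 1 : ℕ) : ℤ) + n + 1 := by
    intro n; push_cast; ring
  simp only [hfin, htail]
  have hX := hsum ((k : ℤ) + 1) (X ((k : ℤ) + 1))
  have h0 : ∀ (j : ℤ) (y : EuclideanSpace ℝ (Fin M)), Phi A j 0 y = y := fun _ _ => rfl
  have h0' : ∀ (j : ℤ) (y : EuclideanSpace ℝ (Fin M)), (Phi A j 0).symm y = y := fun _ _ => rfl
  simp only [h0, h0', Nat.cast_zero, sub_zero, add_zero, Nat.cast_succ]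
  rw [eq_sub_of_add_eq' hX]
  abel

theorem proj_vpivot_zero (hPp : ∀ k x, Pp k (Pp k x) = Pp k x)
    (hsum : ∀ k x, Pp k x + Pm k x = x)
    (hequiv : ∀ k x, A k (Pp k x) = Pp (k + 1) (A k x))
    (hs : Summable fun n : ℕ =>
      (Phi A 0 (n + 1)).symm (Pp ((0 : ℤ) + n + 1) (X ((0 : ℤ) + n + 1)))) :
    Pm 0 (vpivot A Pp Pm X 0) = 0 := by
  unfold vpivot
  rw [Finset.sum_range_zero, zero_sub, map_neg, Nat.cast_zero, (Pm 0).map_tsum hs, neg_eq_zero]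
  refine (tsum_congr fun n => ?_).trans tsum_zero
  have h := Phi_symm_proj hequiv 0 (n + 1) (X ((0 : ℤ) + n + 1))
  rw [Nat.cast_succ, ← add_assoc] at h
  rw [h]
  have h2 := hsum 0 (Pp 0 ((Phi A 0 (n + 1)).symm (X ((0 : ℤ) + n + 1))))
  rwa [hPp, add_eq_left] at h2

theorem norm_vpivot_le
    (hs : ∀ k : ℤ, Summable fun n : ℕ => ‖Phi A (k - n) n (Pm (k - n) (X (k - n)))‖)
    (hu : ∀ k : ℤ, Summable fun n : ℕ =>
      ‖(Phi A k (n + 1)).symm (Pp (k + n + 1) (X (k + n + 1)))‖) (k : ℕ) :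
    ‖vpivot A Pp Pm X k‖ ≤ vabs A Pp Pm X (k : ℤ) := by
  unfold vpivot vabs
  refine (norm_sub_le _ _).trans (add_le_add ((norm_sum_le _ _).trans ?_)
    (norm_tsum_le_tsum_norm (hu k)))
  exact (hs k).sum_le_tsum _ fun _ _ => norm_nonneg _

theorem norm_vpivot_zero_sub_sdir_le
    (hs : ∀ k : ℤ, Summable fun n : ℕ => ‖Phi A (k - n) n (Pm (k - n) (X (k - n)))‖) :
    ‖vpivot A Pp Pm X 0 - sdir A Pp Pm X 0‖ ≤ vabs A Pp Pm X 0 := by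
  unfold vpivot sdir vabs
  rw [Finset.sum_range_zero, Nat.cast_zero, sub_sub_sub_cancel_right, zero_sub, norm_neg]
  exact (norm_tsum_le_tsum_norm (hs 0)).trans
    (le_add_of_nonneg_right (tsum_nonneg fun _ => norm_nonneg _))

end Cocycle

/-- First-order optimality: if `v` has least `ℓ²` norm on the line `v + t e`, then `v ⟂ e`. -/
theorem sum_inner_eq_zero_of_forall_sum_norm_sq_le {ι E : Type*} [NormedAddCommGroup E]
    [InnerProductSpace ℝ E] (s : Finset ι) (v e : ι → E)
    (h : ∀ t : ℝ, ∑ i ∈ s, ‖v i‖ ^ 2 ≤ ∑ i ∈ s, ‖v i + t • e i‖ ^ 2) :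
    ∑ i ∈ s, inner ℝ (v i) (e i) = 0 := by
  have hq : ∀ t : ℝ, 0 ≤ (∑ i ∈ s, ‖e i‖ ^ 2) * (t * t)
      + (2 * ∑ i ∈ s, inner ℝ (v i) (e i)) * t + 0 := by
    intro t
    have ht := h t
    have hexp : ∑ i ∈ s, ‖v i + t • e i‖ ^ 2 = ∑ i ∈ s, ‖v i‖ ^ 2
        + ((∑ i ∈ s, ‖e i‖ ^ 2) * (t * t) + (2 * ∑ i ∈ s, inner ℝ (v i) (e i)) * t) := by
      simp only [Finset.mul_sum, Finset.sum_mul, ← Finset.sum_add_distrib]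
      refine Finset.sum_congr rfl fun i _ => ?_
      rw [norm_add_sq_real, inner_smul_right, norm_smul, mul_pow, Real.norm_eq_abs, sq_abs]
      ring
    linarith
  have hd := discrim_le_zero hq
  rw [discrim, mul_zero, sub_zero] at hd
  have := pow_eq_zero_iff two_ne_zero |>.1 (le_antisymm hd (sq_nonneg _))
  linarith

/-- Peak error bounds for non-intrusive shadowing:
`e^{PN}_k := v^P_k − v^N_k ∈ range P⁺_k` for `0 ≤ k ≤ K−1`,
`‖e^{PN}_{K−1}‖ ≤ Σ_{k<K} λ^{K−1−k} v^A_k`, and `‖v^P_0 − v_0‖ ≤ v^A_0`,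
where `v^N` minimizes `Σ_{k<K} ‖·‖²` over inhomogeneous tangent solutions on
`0,…,K−1` with `P⁻_0 v_0 = 0`. -/
theorem stmt10 (M : ℕ) (hM : 0 < M)
    (A : ℤ → EuclideanSpace ℝ (Fin M) ≃L[ℝ] EuclideanSpace ℝ (Fin M))
    (Pp Pm : ℤ → EuclideanSpace ℝ (Fin M) →L[ℝ] EuclideanSpace ℝ (Fin M))
    (hPp : ∀ k x, Pp k (Pp k x) = Pp k x)
    (hPm : ∀ k x, Pm k (Pm k x) = Pm k x)
    (hsum : ∀ k x, Pp k x + Pm k x = x)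
    (hequiv : ∀ k x, A k (Pp k x) = Pp (k + 1) (A k x))
    (lam : ℝ) (hlam0 : 0 < lam) (hlam1 : lam < 1)
    (hstab : ∀ (k : ℤ) (n : ℕ) (x), ‖Phi A k n (Pm k x)‖ ≤ lam ^ n * ‖x‖)
    (hunstab : ∀ (k : ℤ) (n : ℕ) (x), ‖(Phi A (k - n) n).symm (Pp k x)‖ ≤ lam ^ n * ‖x‖)
    (X : ℤ → EuclideanSpace ℝ (Fin M)) (χ : ℝ) (hχ : ∀ k, ‖X k‖ ≤ χ)
    (K : ℕ) (hK : 1 ≤ K)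
    (vN : ℕ → EuclideanSpace ℝ (Fin M))
    (hfeas1 : ∀ k : ℕ, k + 2 ≤ K → vN (k + 1) = A (k : ℤ) (vN k) + X ((k : ℤ) + 1))
    (hfeas2 : Pm 0 (vN 0) = 0)
    (hmin : ∀ w : ℕ → EuclideanSpace ℝ (Fin M),
      (∀ k : ℕ, k + 2 ≤ K → w (k + 1) = A (k : ℤ) (w k) + X ((k : ℤ) + 1)) →
      Pm 0 (w 0) = 0 →
      (∑ k ∈ Finset.range K, ‖vN k‖ ^ 2) ≤ ∑ k ∈ Finset.range K, ‖w k‖ ^ 2) :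
    (∀ k : ℕ, k < K → vpivot A Pp Pm X k - vN k ∈ Set.range (Pp (k : ℤ)))
    ∧ ‖vpivot A Pp Pm X (K - 1) - vN (K - 1)‖
        ≤ ∑ k ∈ Finset.range K, lam ^ (K - 1 - k) * vabs A Pp Pm X (k : ℤ)
    ∧ ‖vpivot A Pp Pm X 0 - sdir A Pp Pm X 0‖ ≤ vabs A Pp Pm X 0 := by
  have hs := summable_norm_stable (X := X) hlam0 hlam1 hstab hχ
  have hu := summable_norm_unstable (X := X) hlam0 hlam1 hunstab hχ
  set e : ℕ → EuclideanSpace ℝ (Fin M) := fun k => vpivot A Pp Pm X k - vN k with he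
  have hestep : ∀ k : ℕ, k + 2 ≤ K → e (k + 1) = A (k : ℤ) (e k) := by
    intro k hk
    simp only [he, vpivot_succ hsum k (hu k).of_norm, hfeas1 k hk, map_sub]
    abel
  have he0 : Pm 0 (e 0) = 0 := by
    simp only [he, map_sub, hfeas2, sub_zero]
    exact proj_vpivot_zero hPp hsum hequiv (hu 0).of_norm
  have heP : ∀ k : ℕ, k < K → Pp (k : ℤ) (e k) = e k := by
    intro k
    induction k with
    | zero =>
      intro _
      simpa [he0] using hsum 0 (e 0)
    | succ k ih =>
      intro hk
      rw [hestep k (by omega), Nat.cast_succ, ← hequiv, ih (by omega)]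
  have hePhi : ∀ k n : ℕ, k + n < K → e (k + n) = Phi A (k : ℤ) n (e k) := by
    intro k n
    induction n with
    | zero => intro _; rfl
    | succ n ih =>
      intro hk
      rw [← add_assoc, hestep (k + n) (by omega), ih (by omega), Phi_succ_apply, Nat.cast_add]
  have hdecay : ∀ k : ℕ, k < K → ‖e k‖ ≤ lam ^ (K - 1 - k) * ‖e (K - 1)‖ := by
    intro k hk
    have hkn : k + (K - 1 - k) = K - 1 := by omega
    have h := norm_Phi_symm_le hunstab (k : ℤ) (K - 1 - k) (e (K - 1))
    rw [← Nat.cast_add, hkn, heP (K - 1) (by omega)] at h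
    have h2 := hePhi k (K - 1 - k) (by omega)
    rw [hkn] at h2
    rwa [h2, ContinuousLinearEquiv.symm_apply_apply, ← h2] at h
  refine ⟨fun k hk => ⟨e k, heP k hk⟩, ?_, norm_vpivot_zero_sub_sdir_le hs⟩
  have horth : ∑ k ∈ Finset.range K, inner ℝ (vN k) (e k) = 0 := by
    refine sum_inner_eq_zero_of_forall_sum_norm_sq_le _ _ _ fun t =>
      hmin (fun k => vN k + t • e k) (fun k hk => ?_) ?_
    · simp only [hfeas1 k hk, hestep k hk, map_add, map_smul]
      abel
    · simp only [map_add, map_smul, hfeas2, he0, smul_zero, add_zero]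
  have hsq : ∑ k ∈ Finset.range K, ‖e k‖ ^ 2
      = ∑ k ∈ Finset.range K, inner ℝ (vpivot A Pp Pm X k) (e k) := by
    rw [← sub_zero (∑ k ∈ Finset.range K, inner ℝ (vpivot A Pp Pm X k) (e k)), ← horth,
      ← Finset.sum_sub_distrib]
    refine Finset.sum_congr rfl fun k _ => ?_
    rw [← inner_sub_left, ← real_inner_self_eq_norm_sq]
  have hlast : ‖e (K - 1)‖ ^ 2 ≤ ∑ k ∈ Finset.range K, ‖e k‖ ^ 2 :=
    Finset.single_le_sum (f := fun k => ‖e k‖ ^ 2) (fun _ _ => sq_nonneg _)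
      (Finset.mem_range.2 (by omega))
  have hbound : ∑ k ∈ Finset.range K, inner ℝ (vpivot A Pp Pm X k) (e k)
      ≤ (∑ k ∈ Finset.range K, lam ^ (K - 1 - k) * vabs A Pp Pm X (k : ℤ)) * ‖e (K - 1)‖ := by
    rw [Finset.sum_mul]
    refine Finset.sum_le_sum fun k hk => (real_inner_le_norm _ _).trans ?_
    have hv := norm_vpivot_le hs hu k
    refine (mul_le_mul hv (hdecay k (Finset.mem_range.1 hk)) (norm_nonneg _)
      ((norm_nonneg _).trans hv)).trans_eq ?_
    ring
  have hnonneg : 0 ≤ ∑ k ∈ Finset.range K, lam ^ (K - 1 - k) * vabs A Pp Pm X (k : ℤ) :=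
    Finset.sum_nonneg fun k _ =>
      mul_nonneg (pow_nonneg hlam0.le _) ((norm_nonneg _).trans (norm_vpivot_le hs hu k))
  change ‖e (K - 1)‖ ≤ _
  rcases (norm_nonneg (e (K - 1))).eq_or_lt with h0 | hpos
  · rwa [← h0]
  · refine le_of_mul_le_mul_right ?_ hpos
    rw [← sq]
    exact (hlast.trans_eq hsq).trans hbound
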